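/- arXiv:2009.06486 — 2 statements merged into one kernel-verified Lean document; each statement's English description precedes it below -/
import Mathlib

section
/- Counterexample to gradient regularity for small opening angle (Theorem 1.2(ii) / Section 6, case θ₀ ∈ (0,π/2)). Let θ₀ ∈ (0, π/2). There exists s₀ ∈ (−π/2, 0), depending on θ₀, such that for every s ∈ (−π/2, s₀) there exist α = α(θ₀, s) ∈ (0,1) and a function u : 𝒞̄ → ℝ with the following properties: u is continuous on 𝒞̄ and smooth on 𝒞̄ ∖ {0}; u is axi-symmetric; u is positively homogeneous of degree α (u(λx) = λ^α u(x) for all λ > 0 and x ∈ 𝒞̄); u is not identically zero; Δu = 0 in 𝒞; and β·Du = 0 at every point of Γ_cone, where β(x) = sin(s)·(x'/|x'|, 0) + cos(s)·e₃. Consequently u is α-Hölder continuous on 𝒞̄ ∩ B₁(0), but for every ε > 0 the function u is not (α+ε)-Hölder continuous in any neighbourhood of the origin; in particular u is not C¹ up to the origin. -/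
noncomputable section
open Real Set

abbrev Euc3 := EuclideanSpace ℝ (Fin 3)

/-- Partial derivative in the `i`-th coordinate direction. -/
def pd3 (i : Fin 3) (u : Euc3 → ℝ) (x : Euc3) : ℝ :=
  fderiv ℝ u x (EuclideanSpace.single i 1)

/-- Second partial derivative `∂_i ∂_j u`. -/
def pd3₂ (i j : Fin 3) (u : Euc3 → ℝ) (x : Euc3) : ℝ :=
  pd3 i (pd3 j u) x

/-- The Laplacian on `ℝ³`. -/
def lap3 (u : Euc3 → ℝ) (x : Euc3) : ℝ := ∑ i : Fin 3, pd3₂ i i u x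

/-- The polar angle `θ(x) ∈ [0,π]`, defined by `‖x‖ cos θ = x₃`. -/
def polarAngle3 (x : Euc3) : ℝ := Real.arccos (x 2 / ‖x‖)

/-- The open cone `𝒞 = {x : r > 0, θ(x) < θ₀}`. -/
def cone3 (θ₀ : ℝ) : Set Euc3 := {x | 0 < ‖x‖ ∧ polarAngle3 x < θ₀}

/-- The lateral boundary `Γ_cone = {x ≠ 0 : θ(x) = θ₀}`. -/
def coneBdry3 (θ₀ : ℝ) : Set Euc3 := {x | 0 < ‖x‖ ∧ polarAngle3 x = θ₀}

/-- Axi-symmetry: `u` depends only on `(x₃, |x'|)`. -/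
def axisym3 (u : Euc3 → ℝ) : Prop :=
  ∀ x x' : Euc3, x 2 = x' 2 → (x 0) ^ 2 + (x 1) ^ 2 = (x' 0) ^ 2 + (x' 1) ^ 2 → u x = u x'

/-- The boundary vector field `β(x) = sin s · (x'/|x'|, 0) + cos s · e₃`. -/
def obliqueVec3 (s : ℝ) (x : Euc3) : Euc3 :=
  (WithLp.equiv 2 (Fin 3 → ℝ)).symm
    ![Real.sin s * x 0 / Real.sqrt ((x 0) ^ 2 + (x 1) ^ 2),
      Real.sin s * x 1 / Real.sqrt ((x 0) ^ 2 + (x 1) ^ 2),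
      Real.cos s]

/-- All the properties asserted of the counterexample solution `u`:
continuity on `𝒞̄`, smoothness away from the vertex, axi-symmetry, positive
`α`-homogeneity, non-triviality, harmonicity, the homogeneous oblique boundary
condition, `α`-Hölder continuity near the vertex, failure of `(α+ε)`-Hölder
continuity in every neighbourhood of the vertex, and failure of `C¹` regularity
up to the vertex. -/
def counterexampleProps (θ₀ s α : ℝ) (u : Euc3 → ℝ) : Prop :=
  ContinuousOn u (closure (cone3 θ₀)) ∧
  ContDiffOn ℝ (⊤ : ℕ∞) u (closure (cone3 θ₀) \ {0}) ∧
  axisym3 u ∧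
  (∀ l : ℝ, 0 < l → ∀ x ∈ closure (cone3 θ₀), u (l • x) = l ^ α * u x) ∧
  (∃ x ∈ closure (cone3 θ₀), u x ≠ 0) ∧
  (∀ x ∈ cone3 θ₀, lap3 u x = 0) ∧
  (∀ x ∈ coneBdry3 θ₀, fderivWithin ℝ u (closure (cone3 θ₀)) x (obliqueVec3 s x) = 0) ∧
  (∃ K : NNReal, HolderOnWith K α.toNNReal u (closure (cone3 θ₀) ∩ Metric.closedBall 0 1)) ∧
  (∀ ε : ℝ, 0 < ε → ∀ K : NNReal, ∀ δ : ℝ, 0 < δ →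
    ¬ HolderOnWith K (α + ε).toNNReal u (closure (cone3 θ₀) ∩ Metric.ball 0 δ)) ∧
  ¬ ∃ G : Euc3 → (Euc3 →L[ℝ] ℝ), ContinuousOn G (closure (cone3 θ₀)) ∧
      ∀ x ∈ closure (cone3 θ₀) \ {0}, G x = fderivWithin ℝ u (closure (cone3 θ₀)) x


/-! ### Power series -/

def pS (c : ℕ → ℝ) (t : ℝ) : ℝ := ∑' n, c n * t ^ n

def dC (c : ℕ → ℝ) (n : ℕ) : ℝ := (n + 1) * c (n + 1)

def polyBdd (c : ℕ → ℝ) : Prop := ∃ C : ℝ, ∃ k : ℕ, ∀ n, |c n| ≤ C * ((n : ℝ) + 1) ^ k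

lemma summable_poly (k : ℕ) {r : ℝ} (h0 : 0 ≤ r) (hr : r < 1) :
    Summable (fun n : ℕ => ((n : ℝ) + 1) ^ k * r ^ n) := by
  rcases h0.eq_or_lt with h | h
  · subst h
    apply summable_of_ne_finset_zero (s := {0})
    intro b hb
    simp at hb
    simp [hb]
  have h1 := summable_pow_mul_geometric_of_norm_lt_one (R := ℝ) k (r := r)
    (by rw [Real.norm_eq_abs, abs_of_nonneg h0]; exact hr)
  have h2 := (summable_nat_add_iff 1).2 h1
  have h3 := h2.mul_right r⁻¹
  refine h3.congr (fun n => ?_)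
  push_cast
  rw [pow_succ]
  field_simp

lemma polyBdd.dC {c : ℕ → ℝ} (h : polyBdd c) : polyBdd (dC c) := by
  obtain ⟨C, k, h⟩ := h
  have hC : 0 ≤ C := by
    have := h 0
    simp at this
    exact (abs_nonneg _).trans this
  refine ⟨C * 2 ^ k, k + 1, fun n => ?_⟩
  unfold _root_.dC
  rw [abs_mul, abs_of_nonneg (by positivity : (0 : ℝ) ≤ n + 1)]
  have h1 := h (n + 1)
  push_cast at h1
  have h2 : ((n : ℝ) + 1 + 1) ^ k ≤ (2 * (n + 1)) ^ k := by
    gcongr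
    have : (0 : ℝ) ≤ n := by positivity
    linarith
  calc ((n : ℝ) + 1) * |c (n + 1)| ≤ (n + 1) * (C * (2 * (n + 1)) ^ k) := by
        gcongr
        exact h1.trans (by gcongr)
    _ = _ := by rw [mul_pow]; ring

lemma polyBdd.summable {c : ℕ → ℝ} (h : polyBdd c) {t : ℝ} (ht : |t| < 1) :
    Summable (fun n => c n * t ^ n) := by
  obtain ⟨C, k, h⟩ := h
  refine Summable.of_norm_bounded (g := fun n : ℕ => C * (((n : ℝ) + 1) ^ k * |t| ^ n))
    ((summable_poly k (abs_nonneg t) ht).mul_left C) (fun n => ?_)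
  rw [Real.norm_eq_abs, abs_mul, abs_pow, ← mul_assoc]
  gcongr
  exact h n

lemma polyBdd.hasDerivAt {c : ℕ → ℝ} (h : polyBdd c) {t : ℝ} (ht : |t| < 1) :
    HasDerivAt (pS c) (pS (_root_.dC c) t) t := by
  have hd := h.dC
  obtain ⟨r, hr1, hr2⟩ := exists_between ht
  have hr0 : 0 ≤ r := (abs_nonneg t).trans hr1.le
  obtain ⟨C, k, hb⟩ := id hd
  let u : ℕ → ℝ := fun n => if n = 0 then 0 else C * (((n - 1 : ℕ) : ℝ) + 1) ^ k * r ^ (n - 1)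
  have hu : Summable u := by
    rw [← summable_nat_add_iff 1]
    refine ((summable_poly k hr0 hr2).mul_left C).congr (fun n => ?_)
    simp [u, mul_assoc]
  have key := hasDerivAt_tsum_of_isPreconnected (u := u) (g := fun n y => c n * y ^ n)
    (g' := fun n y => c n * (n * y ^ (n - 1))) (t := Metric.ball 0 r) (y₀ := t) (y := t) hu
    Metric.isOpen_ball (convex_ball 0 r).isPreconnected
    (fun n y _ => (hasDerivAt_pow n y).const_mul _) ?_ (by simpa using hr1)
    (h.summable ht) (by simpa using hr1)
  · have : (∑' n, c n * ((n : ℝ) * t ^ (n - 1))) = pS (_root_.dC c) t := by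
      have hs : Summable (fun n => c n * ((n : ℝ) * t ^ (n - 1))) := by
        rw [← summable_nat_add_iff 1]
        refine (hd.summable ht).congr (fun n => ?_)
        simp [_root_.dC]; ring
      rw [hs.tsum_eq_zero_add]
      simp only [pS, _root_.dC]
      simp
      congr 1; ext n; ring
    rw [this] at key
    exact key
  · intro n y hy
    rcases n with _ | n
    · simp [u]
    · have h1 := hb n
      have hy' : |y| ≤ r := by
        have : |y| < r := by simpa using hy
        exact this.le
      simp only [u, Nat.add_sub_cancel, Real.norm_eq_abs]
      rw [if_neg (by omega)]
      calc |c (n+1) * (((n+1 : ℕ) : ℝ) * y ^ n)| = |_root_.dC c n| * |y| ^ n := by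
            rw [← abs_pow, ← abs_mul]; simp only [_root_.dC]; push_cast; ring_nf
        _ ≤ _ := by
          have : 0 ≤ C * ((n : ℝ) + 1) ^ k := (abs_nonneg _).trans h1
          gcongr

lemma polyBdd.contDiffOn {c : ℕ → ℝ} (h : polyBdd c) (n : ℕ) :
    ContDiffOn ℝ n (pS c) (Metric.ball 0 1) := by
  induction n generalizing c with
  | zero =>
    have : ContinuousOn (pS c) (Metric.ball 0 1) := fun t ht =>
      (h.hasDerivAt (by simpa using ht)).continuousAt.continuousWithinAt
    exact_mod_cast contDiffOn_zero.2 this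
  | succ n ih =>
    push_cast
    rw [contDiffOn_succ_iff_deriv_of_isOpen Metric.isOpen_ball]
    refine ⟨fun t ht => (h.hasDerivAt (by simpa using ht)).differentiableAt.differentiableWithinAt,
      by simp, ?_⟩
    exact (ih h.dC).congr (fun t ht => (h.hasDerivAt (by simpa using ht)).deriv)

lemma polyBdd.contDiffAt {c : ℕ → ℝ} (h : polyBdd c) {t : ℝ} (ht : |t| < 1) :
    ContDiffAt ℝ (⊤ : ℕ∞) (pS c) t := by
  have : ContDiffOn ℝ (⊤ : ℕ∞) (pS c) (Metric.ball 0 1) := by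
    rw [contDiffOn_infty]
    exact fun n => h.contDiffOn n
  exact this.contDiffAt (Metric.isOpen_ball.mem_nhds (by simpa using ht))

/-! ### Coefficients -/

def eC (a : ℝ) : ℕ → ℝ
  | 0 => 1
  | n + 1 => eC a n * (((n + 1) * (n + 2) - a * (a + 1)) / (n + 2) ^ 2)

def cC (a : ℝ) : ℕ → ℝ
  | 0 => 1
  | n + 1 => -(a * (a + 1)) * eC a n

def EC (a : ℝ) (n : ℕ) : ℝ := (n + 1) * eC a n

lemma cC_rec (a : ℝ) (n : ℕ) :
    ((n : ℝ) + 1) ^ 2 * cC a (n + 1) = (n * (n + 1) - a * (a + 1)) * cC a n := by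
  rcases n with _ | n
  · simp [cC, eC]
  · simp only [cC, eC]
    push_cast
    have : (n : ℝ) + 2 ≠ 0 := by positivity
    field_simp
    ring

lemma eC_bd {a : ℝ} (ha : a ∈ Icc (0 : ℝ) 1) (n : ℕ) : |eC a n| ≤ 1 := by
  induction n with
  | zero => simp [eC]
  | succ n ih =>
    simp only [eC]
    rw [abs_mul]
    have hn : (0 : ℝ) ≤ n := by positivity
    have h0 : a * (a + 1) ≤ 2 := by nlinarith [ha.1, ha.2]
    have h1 : 0 ≤ a * (a + 1) := by nlinarith [ha.1, ha.2]
    have : |(((n : ℝ) + 1) * (n + 2) - a * (a + 1)) / (n + 2) ^ 2| ≤ 1 := by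
      rw [abs_of_nonneg (div_nonneg (by nlinarith) (by positivity))]
      rw [div_le_one (by positivity)]
      nlinarith
    exact mul_le_one₀ ih (abs_nonneg _) this

lemma cC_bd {a : ℝ} (ha : a ∈ Icc (0 : ℝ) 1) (n : ℕ) : |cC a n| ≤ 2 := by
  rcases n with _ | n
  · simp [cC]
  · simp only [cC]
    have h0 : a * (a + 1) ≤ 2 := by nlinarith [ha.1, ha.2]
    have h1 : 0 ≤ a * (a + 1) := by nlinarith [ha.1, ha.2]
    rw [abs_mul, abs_neg, abs_of_nonneg h1]
    have := eC_bd ha n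
    nlinarith [abs_nonneg (eC a n)]

lemma cC_pb {a : ℝ} (ha : a ∈ Icc (0 : ℝ) 1) : polyBdd (cC a) :=
  ⟨2, 0, fun n => by simpa using cC_bd ha n⟩

lemma EC_pb {a : ℝ} (ha : a ∈ Icc (0 : ℝ) 1) : polyBdd (EC a) :=
  ⟨1, 1, fun n => by
    rw [EC, abs_mul, abs_of_nonneg (by positivity : (0 : ℝ) ≤ n + 1)]
    have := eC_bd ha n
    have hn : (0 : ℝ) ≤ n := by positivity
    nlinarith⟩

lemma eC_cont (n : ℕ) : Continuous (fun a => eC a n) := by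
  induction n with
  | zero => simp only [eC]; fun_prop
  | succ n ih => simp only [eC]; fun_prop

lemma cC_cont (n : ℕ) : Continuous (fun a => cC a n) := by
  rcases n with _ | n
  · simp only [cC]; fun_prop
  · have := eC_cont n
    simp only [cC]; fun_prop

lemma pS_cC_cont {t : ℝ} (ht : |t| < 1) : ContinuousOn (fun a => pS (cC a) t) (Icc 0 1) := by
  unfold pS
  refine continuousOn_tsum (u := fun n : ℕ => 2 * |t| ^ n)
    (fun n => ((cC_cont n).mul continuous_const).continuousOn)
    ((summable_geometric_of_lt_one (abs_nonneg t) ht).mul_left 2) (fun n a ha => ?_)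
  rw [Real.norm_eq_abs, abs_mul, abs_pow]
  gcongr
  exact cC_bd ha n

lemma pS_EC_cont {t : ℝ} (ht : |t| < 1) : ContinuousOn (fun a => pS (EC a) t) (Icc 0 1) := by
  unfold pS
  refine continuousOn_tsum (u := fun n : ℕ => ((n : ℝ) + 1) ^ 1 * |t| ^ n)
    (fun n => ?_)
    (summable_poly 1 (abs_nonneg t) ht) (fun n a ha => ?_)
  · have := eC_cont n
    unfold EC
    fun_prop
  · rw [Real.norm_eq_abs, abs_mul, abs_pow]
    gcongr
    rw [EC, abs_mul, abs_of_nonneg (by positivity : (0 : ℝ) ≤ n + 1)]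
    have := eC_bd ha n
    have hn : (0 : ℝ) ≤ n := by positivity
    nlinarith

lemma pS_dC (a t : ℝ) : pS (dC (cC a)) t = -(a * (a + 1)) * pS (EC a) t := by
  unfold pS
  rw [← tsum_mul_left]
  congr 1; ext n
  simp only [dC, cC, EC]; ring

lemma pS_zero (c : ℕ → ℝ) : pS c 0 = c 0 := by
  unfold pS
  rw [tsum_eq_single 0 (by intro n hn; simp [hn])]
  simp

lemma pS_cC_0 (t : ℝ) : pS (cC 0) t = 1 := by
  unfold pS
  rw [tsum_eq_single 0]
  · simp [cC]
  · intro n hn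
    obtain ⟨m, rfl⟩ := Nat.exists_eq_succ_of_ne_zero hn
    simp [cC]

lemma eC_0 (n : ℕ) : ((n : ℝ) + 1) * eC 0 n = 1 := by
  induction n with
  | zero => simp [eC]
  | succ n ih =>
    simp only [eC]
    push_cast
    have : (n : ℝ) + 2 ≠ 0 := by positivity
    have h2 : (n : ℝ) + 1 ≠ 0 := by positivity
    have : eC 0 n = 1 / (n + 1) := by field_simp; linarith
    rw [this]
    field_simp
    ring

lemma pS_EC_0 {t : ℝ} (ht : |t| < 1) : pS (EC 0) t = (1 - t)⁻¹ := by
  unfold pS EC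
  simp_rw [eC_0, one_mul]
  exact tsum_geometric_of_norm_lt_one ht

lemma eC_1 (n : ℕ) : eC 1 (n + 1) = 0 := by
  induction n with
  | zero => simp [eC]; norm_num
  | succ n ih => rw [eC, ih]; simp

lemma pS_EC_1 (t : ℝ) : pS (EC 1) t = 1 := by
  unfold pS
  rw [tsum_eq_single 0]
  · simp [EC, eC]
  · intro n hn
    obtain ⟨m, rfl⟩ := Nat.exists_eq_succ_of_ne_zero hn
    simp [EC, eC_1]

lemma pS_cC_1 (t : ℝ) : pS (cC 1) t = 1 - 2 * t := by
  unfold pS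
  rw [tsum_eq_sum (s := Finset.range 2)]
  · simp [Finset.sum_range_succ, cC, eC]; ring
  · intro n hn
    simp at hn
    obtain ⟨m, rfl⟩ := Nat.exists_eq_add_of_le hn
    rw [show 2 + m = (m + 1) + 1 by ring]
    simp [cC, eC_1]

lemma mul_pS {c : ℕ → ℝ} (h : polyBdd c) {t : ℝ} (ht : |t| < 1) :
    HasSum (fun n : ℕ => (n : ℝ) * c n * t ^ n) (t * pS (dC c) t) := by
  rw [← hasSum_nat_add_iff' 1]
  have := (h.dC.summable ht).hasSum.mul_left t
  simp only [Finset.sum_range_one]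
  have e1 : (fun n : ℕ => ((n + 1 : ℕ) : ℝ) * c (n + 1) * t ^ (n + 1))
      = fun i => t * (dC c i * t ^ i) := by
    ext n; simp only [dC]; push_cast; ring
  rw [e1]
  simpa [pS] using this

lemma ode {a : ℝ} (ha : a ∈ Icc (0 : ℝ) 1) {t : ℝ} (ht : |t| < 1) :
    t * (1 - t) * pS (dC (dC (cC a))) t + (1 - 2 * t) * pS (dC (cC a)) t
      + a * (a + 1) * pS (cC a) t = 0 := by
  have hc := cC_pb ha
  have h1 := (hc.summable ht).hasSum
  have h2 := (hc.dC.summable ht).hasSum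
  have h3 := mul_pS hc ht
  have h4 := mul_pS hc.dC ht
  have hb : polyBdd (fun n : ℕ => (n : ℝ) * cC a n) := by
    refine ⟨2, 1, fun n => ?_⟩
    have := cC_bd ha n
    have hn : (0 : ℝ) ≤ n := by positivity
    rw [abs_mul, abs_of_nonneg hn]
    nlinarith
  have h5 := mul_pS hb ht
  have h6 : pS (dC (fun n : ℕ => (n : ℝ) * cC a n)) t
      = t * pS (dC (dC (cC a))) t + pS (dC (cC a)) t := by
    refine (h4.add h2).tsum_eq ▸ ?_
    unfold pS
    congr 1; ext n
    simp only [dC]; push_cast; ring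
  rw [h6] at h5
  have h7 := ((((h4.add h2).sub h5).sub h3).add (h1.mul_left (a * (a + 1))))
  have e1 : (fun b : ℕ => (b : ℝ) * dC (cC a) b * t ^ b + dC (cC a) b * t ^ b
      - b * (b * cC a b) * t ^ b - b * cC a b * t ^ b + a * (a + 1) * (cC a b * t ^ b))
      = fun _ => 0 := by
    ext n
    have := cC_rec a n
    simp only [dC]
    linear_combination (t ^ n) * this
  rw [e1] at h7
  have h9 := h7.unique hasSum_zero
  simp only [pS] at h9 ⊢
  linear_combination h9

/-! ### Differentiation -/

def tt (x : Euc3) : ℝ := (1 - x 2 / ‖x‖) / 2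

def AA (a : ℝ) (f : ℝ → ℝ) (x : Euc3) : ℝ := ‖x‖ ^ a * f (tt x)

lemma hasFDerivAt_nrm {x : Euc3} (hx : x ≠ 0) :
    HasFDerivAt (fun y : Euc3 => ‖y‖) (‖x‖⁻¹ • innerSL ℝ x) x := by
  have h1 := (hasStrictFDerivAt_norm_sq (F := Euc3) x).hasFDerivAt
  have hn : ‖x‖ ≠ 0 := norm_ne_zero_iff.2 hx
  have h2 := h1.sqrt (by positivity)
  have e : (fun y : Euc3 => √(‖y‖ ^ 2)) = fun y => ‖y‖ := by
    ext y; exact Real.sqrt_sq (norm_nonneg y)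
  rw [e] at h2
  refine h2.congr_fderiv ?_
  rw [Real.sqrt_sq (norm_nonneg x)]
  ext v
  simp
  field_simp

def dAA (a : ℝ) (f f' : ℝ → ℝ) (x : Euc3) : Euc3 →L[ℝ] ℝ :=
  (a * AA (a - 2) f x + 1 / 2 * x 2 * AA (a - 3) f' x) • innerSL ℝ x
    - (1 / 2 * AA (a - 1) f' x) • (EuclideanSpace.proj 2 : Euc3 →L[ℝ] ℝ)

lemma AA_sub (a : ℝ) (k : ℕ) (f : ℝ → ℝ) {x : Euc3} (hx : x ≠ 0) :
    AA (a - k) f x = ‖x‖ ^ a * f (tt x) / ‖x‖ ^ k := by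
  have hn : 0 < ‖x‖ := norm_pos_iff.2 hx
  rw [AA, Real.rpow_sub hn, Real.rpow_natCast]; ring

lemma hasFDerivAt_tt {x : Euc3} (hx : x ≠ 0) :
    HasFDerivAt tt ((1 / 2 * x 2 / ‖x‖ ^ 3) • innerSL ℝ x
      - (1 / 2 / ‖x‖) • (EuclideanSpace.proj 2 : Euc3 →L[ℝ] ℝ)) x := by
  have hn : ‖x‖ ≠ 0 := norm_ne_zero_iff.2 hx
  have h1 := (hasDerivAt_inv hn).comp_hasFDerivAt x (hasFDerivAt_nrm hx)
  have h2 : HasFDerivAt (fun y : Euc3 => y 2) (EuclideanSpace.proj 2 : Euc3 →L[ℝ] ℝ) x :=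
    (EuclideanSpace.proj 2 : Euc3 →L[ℝ] ℝ).hasFDerivAt
  have h3 := ((h2.mul h1).const_sub 1).mul_const (1 / 2 : ℝ)
  have e : tt = fun y : Euc3 => (1 - y 2 * (Inv.inv ∘ fun z : Euc3 => ‖z‖) y) * (1 / 2) := by
    ext y; simp [tt]; ring
  rw [e]
  refine h3.congr_fderiv ?_
  ext v
  simp
  field_simp
  ring

lemma hasFDerivAt_AA (a : ℝ) {f f' : ℝ → ℝ} {x : Euc3} (hx : x ≠ 0)
    (hf : HasDerivAt f (f' (tt x)) (tt x)) : HasFDerivAt (AA a f) (dAA a f f' x) x := by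
  have hn : 0 < ‖x‖ := norm_pos_iff.2 hx
  have h1 := (Real.hasDerivAt_rpow_const (p := a) (Or.inl hn.ne')).comp_hasFDerivAt x
    (hasFDerivAt_nrm hx)
  have h2 := hf.comp_hasFDerivAt x (hasFDerivAt_tt hx)
  have h3 := h1.mul h2
  refine h3.congr_fderiv ?_
  have e1 := AA_sub a 1 f' hx
  have e2 := AA_sub a 2 f hx
  have e3 := AA_sub a 3 f' hx
  push_cast at e1 e2 e3
  rw [dAA, e1, e2, e3, Real.rpow_sub hn, Real.rpow_one]
  ext v
  simp
  field_simp
  ring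

lemma innerSL_single (x : Euc3) (i : Fin 3) :
    innerSL ℝ x (EuclideanSpace.single i 1) = x i := by
  simp [EuclideanSpace.inner_single_right]

lemma projE (i : Fin 3) (v : Euc3) : (EuclideanSpace.proj i : Euc3 →L[ℝ] ℝ) v = v i := rfl

def pp (a : ℝ) (f f' : ℝ → ℝ) (i : Fin 3) (x : Euc3) : ℝ :=
  (a * AA (a - 2) f x + 1 / 2 * x 2 * AA (a - 3) f' x) * x i
    - (1 / 2 * AA (a - 1) f' x) * (EuclideanSpace.single i 1 : Euc3) 2

lemma dAA_single (a : ℝ) (f f' : ℝ → ℝ) (i : Fin 3) (x : Euc3) :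
    dAA a f f' x (EuclideanSpace.single i 1) = pp a f f' i x := by
  have := innerSL_single x i
  simp only [dAA, pp, sub_apply, smul_apply, this,
    smul_eq_mul, projE]

lemma norm_sq3 (x : Euc3) : ‖x‖ ^ 2 = x 0 ^ 2 + x 1 ^ 2 + x 2 ^ 2 := by
  rw [EuclideanSpace.norm_sq_eq]
  simp [Fin.sum_univ_three]

lemma hasFDerivAt_pp (a : ℝ) {f f' f'' : ℝ → ℝ} {x : Euc3} (hx : x ≠ 0) (i : Fin 3)
    (hf : HasDerivAt f (f' (tt x)) (tt x)) (hf' : HasDerivAt f' (f'' (tt x)) (tt x)) :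
    HasFDerivAt (pp a f f' i)
     (((a * AA (a - 2) f x + 1 / 2 * x 2 * AA (a - 3) f' x) •
        (EuclideanSpace.proj i : Euc3 →L[ℝ] ℝ)
      + x i • (a • dAA (a - 2) f f' x + ((1 / 2 * x 2) • dAA (a - 3) f' f'' x
        + AA (a - 3) f' x • ((1 / 2 : ℝ) • (EuclideanSpace.proj 2 : Euc3 →L[ℝ] ℝ)))))
      - (EuclideanSpace.single i 1 : Euc3) 2 • ((1 / 2 : ℝ) • dAA (a - 1) f' f'' x)) x := by
  have h2 : ∀ j : Fin 3, HasFDerivAt (fun y : Euc3 => y j)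
      (EuclideanSpace.proj j : Euc3 →L[ℝ] ℝ) x :=
    fun j => (EuclideanSpace.proj j : Euc3 →L[ℝ] ℝ).hasFDerivAt
  exact ((((hasFDerivAt_AA (a - 2) hx hf).const_mul a).add
    (((h2 2).const_mul (1 / 2)).mul (hasFDerivAt_AA (a - 3) hx hf'))).mul (h2 i)).sub
    (((hasFDerivAt_AA (a - 1) hx hf').const_mul (1 / 2)).mul_const _)

lemma lap_AA (a : ℝ) {f f' f'' : ℝ → ℝ} {U : Set Euc3} (hU : IsOpen U)
    (h0 : ∀ x ∈ U, x ≠ 0)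
    (hf : ∀ x ∈ U, HasDerivAt f (f' (tt x)) (tt x))
    (hf' : ∀ x ∈ U, HasDerivAt f' (f'' (tt x)) (tt x))
    (hode : ∀ x ∈ U, tt x * (1 - tt x) * f'' (tt x) + (1 - 2 * tt x) * f' (tt x)
      + a * (a + 1) * f (tt x) = 0) {x : Euc3} (hx : x ∈ U) : lap3 (AA a f) x = 0 := by
  have hp : ∀ i, pd3 i (AA a f) =ᶠ[nhds x] pp a f f' i := by
    intro i
    filter_upwards [hU.mem_nhds hx] with y hy
    rw [pd3, (hasFDerivAt_AA a (h0 y hy) (hf y hy)).fderiv, dAA_single]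
  have hxx := h0 x hx
  have hn : 0 < ‖x‖ := norm_pos_iff.2 hxx
  have hpp : ∀ i, pd3₂ i i (AA a f) x = fderiv ℝ (pp a f f' i) x (EuclideanSpace.single i 1) := by
    intro i
    rw [pd3₂, pd3, (hp i).fderiv_eq]
  simp only [lap3, hpp, Fin.sum_univ_three,
    (hasFDerivAt_pp a hxx _ (hf x hx) (hf' x hx)).fderiv]
  simp only [sub_apply, add_apply,
    smul_apply, smul_eq_mul, projE, dAA_single, pp]
  have k1 := AA_sub a 1
  have k2 := AA_sub a 2
  have k3 := AA_sub a 3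
  have k4 := AA_sub a 4
  have k5 := AA_sub a 5
  have k6 := AA_sub a 6
  push_cast at k1 k2 k3 k4 k5 k6
  have z0 : (EuclideanSpace.single (0 : Fin 3) (1 : ℝ) : Euc3) 2 = 0 := by simp
  have z1 : (EuclideanSpace.single (1 : Fin 3) (1 : ℝ) : Euc3) 2 = 0 := by simp
  have z2 : (EuclideanSpace.single (2 : Fin 3) (1 : ℝ) : Euc3) 2 = 1 := by simp
  simp only [sub_sub, z0, z1, z2]
  norm_num
  have hsq := norm_sq3 x
  rw [k2 f hxx, k2 f'' hxx, k3 f' hxx, k4 f hxx, k4 f'' hxx, k5 f' hxx, k6 f'' hxx]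
  have ho := hode x hx
  have htt : tt x = (1 - x 2 / ‖x‖) / 2 := rfl
  generalize f (tt x) = F at *
  generalize f' (tt x) = F1 at *
  generalize f'' (tt x) = F2 at *
  rw [htt] at ho
  have h0' : x 0 ^ 2 = ‖x‖ ^ 2 - x 1 ^ 2 - x 2 ^ 2 := by linarith
  generalize ‖x‖ ^ a = R at *
  generalize ‖x‖ = r at *
  field_simp at ho ⊢
  linear_combination r ^ 2 * R * ho + R * (r * 2 * a * (r * 2 * F * (a - 2) + x 2 * F1)
    + x 2 * (r * 2 * F1 * (a - 3) + x 2 * F2)) * h0'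

/-! ### The cone -/

lemma abs_x2_le (x : Euc3) : |x 2| ≤ ‖x‖ := by
  apply abs_le_of_sq_le_sq _ (norm_nonneg x)
  have := norm_sq3 x
  nlinarith [sq_nonneg (x 0), sq_nonneg (x 1)]

lemma mem_cone_iff {θ₀ : ℝ} (h : θ₀ ∈ Ioo 0 (π / 2)) (x : Euc3) :
    x ∈ cone3 θ₀ ↔ ‖x‖ * cos θ₀ < x 2 := by
  have hx2 := abs_le.1 (abs_x2_le x)
  constructor
  · rintro ⟨hn, hp⟩
    have h1 : -1 ≤ x 2 / ‖x‖ := by rw [le_div_iff₀ hn]; linarith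
    have h2 : x 2 / ‖x‖ ≤ 1 := by rw [div_le_one hn]; linarith
    have := Real.strictAntiOn_cos ⟨Real.arccos_nonneg _, Real.arccos_le_pi _⟩
      ⟨h.1.le, by linarith [h.2, Real.pi_pos]⟩ hp
    rw [Real.cos_arccos h1 h2, lt_div_iff₀ hn] at this
    linarith
  · intro hlt
    have hn : 0 < ‖x‖ := by
      rcases (norm_nonneg x).eq_or_lt with h0 | h0
      · rw [← h0] at hlt hx2; linarith
      · exact h0
    refine ⟨hn, ?_⟩
    rw [polarAngle3]
    have : cos θ₀ < x 2 / ‖x‖ := by rw [lt_div_iff₀ hn]; linarith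
    have h2 : x 2 / ‖x‖ ≤ 1 := by rw [div_le_one hn]; linarith
    rw [← Real.arccos_cos h.1.le (by linarith [h.2, Real.pi_pos] : θ₀ ≤ π)]
    exact Real.strictAntiOn_arccos ⟨Real.neg_one_le_cos _, Real.cos_le_one _⟩
      ⟨(Real.neg_one_le_cos _).trans this.le, h2⟩ this

lemma bdry_eq {θ₀ : ℝ} {x : Euc3} (hx : x ∈ coneBdry3 θ₀) : x 2 = ‖x‖ * cos θ₀ := by
  have hx2 := abs_le.1 (abs_x2_le x)
  obtain ⟨hn, hp⟩ := hx
  have h1 : -1 ≤ x 2 / ‖x‖ := by rw [le_div_iff₀ hn]; linarith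
  have h2 : x 2 / ‖x‖ ≤ 1 := by rw [div_le_one hn]; linarith
  rw [polarAngle3] at hp
  rw [← hp, Real.cos_arccos h1 h2]
  field_simp

lemma cont_coord (i : Fin 3) : Continuous (fun x : Euc3 => x i) :=
  (EuclideanSpace.proj i : Euc3 →L[ℝ] ℝ).continuous

lemma cone_open {θ₀ : ℝ} (h : θ₀ ∈ Ioo 0 (π / 2)) : IsOpen (cone3 θ₀) := by
  have : cone3 θ₀ = {x | ‖x‖ * cos θ₀ < x 2} := by ext x; exact mem_cone_iff h x
  rw [this]
  exact isOpen_lt (by fun_prop) (cont_coord 2)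

def e3 : Euc3 := EuclideanSpace.single 2 1

lemma e3_2 : e3 2 = 1 := by simp [e3]
lemma e3_norm : ‖e3‖ = 1 := by simp [e3]

lemma cos_pos0 {θ₀ : ℝ} (h : θ₀ ∈ Ioo 0 (π / 2)) : 0 < cos θ₀ :=
  Real.cos_pos_of_mem_Ioo ⟨by linarith [h.1, Real.pi_pos], h.2⟩

lemma cos_lt0 {θ₀ : ℝ} (h : θ₀ ∈ Ioo 0 (π / 2)) : cos θ₀ < 1 := by
  rw [← Real.cos_zero]
  exact Real.cos_lt_cos_of_nonneg_of_le_pi le_rfl (by linarith [h.2, Real.pi_pos]) h.1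

lemma mem_closure_iff0 {θ₀ : ℝ} (h : θ₀ ∈ Ioo 0 (π / 2)) (x : Euc3) :
    x ∈ closure (cone3 θ₀) ↔ ‖x‖ * cos θ₀ ≤ x 2 := by
  constructor
  · intro hx
    have hc : IsClosed {x : Euc3 | ‖x‖ * cos θ₀ ≤ x 2} :=
      isClosed_le (by fun_prop) (cont_coord 2)
    exact closure_minimal (fun y hy => ((mem_cone_iff h y).1 hy).le) hc hx
  · intro hx
    have ht : Filter.Tendsto (fun ε : ℝ => x + ε • e3) (nhdsWithin 0 (Ioi 0)) (nhds x) := by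
      have : Continuous (fun ε : ℝ => x + ε • e3) := by fun_prop
      have := (this.tendsto 0).mono_left (nhdsWithin_le_nhds (s := Ioi 0))
      simpa using this
    refine mem_closure_of_tendsto ht ?_
    filter_upwards [self_mem_nhdsWithin] with ε hε
    have hε : 0 < ε := hε
    rw [mem_cone_iff h]
    have h1 : ‖x + ε • e3‖ ≤ ‖x‖ + ε := by
      refine (norm_add_le _ _).trans ?_
      rw [norm_smul, e3_norm, Real.norm_eq_abs, abs_of_pos hε, mul_one]
    have h2 : (x + ε • e3) 2 = x 2 + ε := by
      simp [e3_2]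
    rw [h2]
    have := cos_pos0 h
    have := cos_lt0 h
    nlinarith

lemma closure_convex {θ₀ : ℝ} (h : θ₀ ∈ Ioo 0 (π / 2)) : Convex ℝ (closure (cone3 θ₀)) := by
  intro x hx y hy a b ha hb _
  rw [mem_closure_iff0 h] at *
  have h1 : ‖a • x + b • y‖ ≤ a * ‖x‖ + b * ‖y‖ := by
    refine (norm_add_le _ _).trans ?_
    rw [norm_smul, norm_smul, Real.norm_eq_abs, Real.norm_eq_abs, abs_of_nonneg ha,
      abs_of_nonneg hb]
  have h2 : (a • x + b • y) 2 = a * x 2 + b * y 2 := by simp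
  rw [h2]
  have := cos_pos0 h
  calc ‖a • x + b • y‖ * cos θ₀ ≤ (a * ‖x‖ + b * ‖y‖) * cos θ₀ := by gcongr
    _ = a * (‖x‖ * cos θ₀) + b * (‖y‖ * cos θ₀) := by ring
    _ ≤ _ := by gcongr

lemma smul_e3_mem {θ₀ : ℝ} (h : θ₀ ∈ Ioo 0 (π / 2)) {t : ℝ} (ht : 0 < t) :
    t • e3 ∈ cone3 θ₀ := by
  rw [mem_cone_iff h, norm_smul, e3_norm, Real.norm_eq_abs, abs_of_pos ht]
  have := cos_lt0 h
  simp [e3_2]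
  nlinarith

lemma closure_ud {θ₀ : ℝ} (h : θ₀ ∈ Ioo 0 (π / 2)) :
    UniqueDiffOn ℝ (closure (cone3 θ₀)) := by
  refine uniqueDiffOn_convex (closure_convex h) ⟨(1 : ℝ) • e3, ?_⟩
  exact interior_mono subset_closure ((cone_open h).interior_eq.symm ▸ smul_e3_mem h one_pos)

lemma x2_pos {θ₀ : ℝ} (h : θ₀ ∈ Ioo 0 (π / 2)) {x : Euc3} (hx : x ∈ closure (cone3 θ₀))
    (h0 : x ≠ 0) : 0 < x 2 := by
  rw [mem_closure_iff0 h] at hx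
  have := norm_pos_iff.2 h0
  have := cos_pos0 h
  exact lt_of_lt_of_le (by positivity) hx

lemma ne_zero_of {x : Euc3} (h : 0 < x 2) : x ≠ 0 := by
  rintro rfl; simp at h

lemma tt_mem {x : Euc3} (h : 0 < x 2) : tt x ∈ Icc (0 : ℝ) (1 / 2) := by
  have hn := norm_pos_iff.2 (ne_zero_of h)
  have h1 := (abs_le.1 (abs_x2_le x)).2
  have h2 : x 2 / ‖x‖ ≤ 1 := by rw [div_le_one hn]; exact h1
  have h3 : 0 < x 2 / ‖x‖ := by positivity
  unfold tt
  constructor <;> linarith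

lemma abs_lt_of_mem {t : ℝ} (h : t ∈ Icc (0 : ℝ) (1 / 2)) : |t| < 1 := by
  rw [abs_of_nonneg h.1]; linarith [h.2]

lemma holder_of {f : Euc3 → ℝ} {K : Set Euc3} {C a : ℝ} (hC : 0 ≤ C) (ha : 0 ≤ a)
    (h : ∀ x ∈ K, ∀ y ∈ K, ‖x‖ ≤ ‖y‖ → |f x - f y| ≤ C * ‖x - y‖ ^ a) :
    HolderOnWith C.toNNReal a.toNNReal f K := by
  have h' : ∀ x ∈ K, ∀ y ∈ K, |f x - f y| ≤ C * ‖x - y‖ ^ a := by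
    intro x hx y hy
    rcases le_total ‖x‖ ‖y‖ with hl | hl
    · exact h x hx y hy hl
    · rw [abs_sub_comm, norm_sub_rev]; exact h y hy x hx hl
  intro x hx y hy
  rw [edist_dist, edist_dist, Real.coe_toNNReal a ha,
    ENNReal.ofReal_rpow_of_nonneg dist_nonneg ha]
  change _ ≤ ENNReal.ofReal C * _
  rw [← ENNReal.ofReal_mul hC]
  apply ENNReal.ofReal_le_ofReal
  rw [Real.dist_eq, dist_eq_norm]
  exact h' x hx y hy

lemma AA_bd {b M : ℝ} {f : ℝ → ℝ} (hf : ∀ t ∈ Icc (0 : ℝ) (1 / 2), |f t| ≤ M) {x : Euc3}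
    (hx : 0 < x 2) : |AA b f x| ≤ M * ‖x‖ ^ b := by
  rw [AA, abs_mul, abs_of_nonneg (Real.rpow_nonneg (norm_nonneg x) b), mul_comm]
  have := Real.rpow_nonneg (norm_nonneg x) b
  gcongr
  exact hf _ (tt_mem hx)

lemma dAA_bd {a M : ℝ} (ha : a ∈ Ioo (0 : ℝ) 1) {f f' : ℝ → ℝ}
    (hf : ∀ t ∈ Icc (0 : ℝ) (1 / 2), |f t| ≤ M)
    (hf' : ∀ t ∈ Icc (0 : ℝ) (1 / 2), |f' t| ≤ M) {x : Euc3}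
    (hx : 0 < x 2) : ‖dAA a f f' x‖ ≤ 2 * M * ‖x‖ ^ (a - 1) := by
  have hn := norm_pos_iff.2 (ne_zero_of hx)
  have hM : 0 ≤ M := (abs_nonneg _).trans (hf 0 (by simp))
  have b1 := AA_bd (b := a - 2) hf hx
  have b2 := AA_bd (b := a - 3) hf' hx
  have b3 := AA_bd (b := a - 1) hf' hx
  have r2 : ‖x‖ ^ (a - 1) = ‖x‖ ^ (a - 2) * ‖x‖ := by
    rw [← Real.rpow_add_one hn.ne']; ring_nf
  have r3 : ‖x‖ ^ (a - 2) = ‖x‖ ^ (a - 3) * ‖x‖ := by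
    rw [← Real.rpow_add_one hn.ne']; ring_nf
  have p3 : 0 < ‖x‖ ^ (a - 3) := Real.rpow_pos_of_pos hn _
  have p2 : 0 < ‖x‖ ^ (a - 2) := Real.rpow_pos_of_pos hn _
  have p1 : 0 < ‖x‖ ^ (a - 1) := Real.rpow_pos_of_pos hn _
  have hx2 := abs_x2_le x
  refine ContinuousLinearMap.opNorm_le_bound _ (by positivity) (fun v => ?_)
  simp only [dAA, sub_apply, smul_apply, smul_eq_mul, projE]
  have hi : |innerSL ℝ x v| ≤ ‖x‖ * ‖v‖ := by
    simpa using abs_real_inner_le_norm x v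
  have hv := abs_x2_le v
  have hc : |a * AA (a - 2) f x + 1 / 2 * x 2 * AA (a - 3) f' x|
      ≤ 3 / 2 * M * ‖x‖ ^ (a - 2) := by
    refine (abs_add_le _ _).trans ?_
    rw [abs_mul, abs_mul, abs_mul, abs_of_pos ha.1, abs_of_pos (by norm_num : (0 : ℝ) < 1 / 2)]
    have q1 : a * |AA (a - 2) f x| ≤ 1 * (M * ‖x‖ ^ (a - 2)) := by
      gcongr
      exact ha.2.le
    have q2 : 1 / 2 * |x 2| * |AA (a - 3) f' x| ≤ 1 / 2 * ‖x‖ * (M * ‖x‖ ^ (a - 3)) := by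
      gcongr
    rw [r3] at q1 ⊢
    linarith
  rw [Real.norm_eq_abs]
  refine (abs_sub _ _).trans ?_
  rw [abs_mul, abs_mul, abs_mul, abs_of_pos (by norm_num : (0 : ℝ) < 1 / 2)]
  have q1 : |a * AA (a - 2) f x + 1 / 2 * x 2 * AA (a - 3) f' x| * |innerSL ℝ x v|
      ≤ (3 / 2 * M * ‖x‖ ^ (a - 2)) * (‖x‖ * ‖v‖) := by gcongr
  have q2 : 1 / 2 * |AA (a - 1) f' x| * |v 2| ≤ 1 / 2 * (M * ‖x‖ ^ (a - 1)) * ‖v‖ := by gcongr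
  rw [r2] at q2 ⊢
  linarith

lemma AA_zero {a : ℝ} (ha : 0 < a) (f : ℝ → ℝ) : AA a f 0 = 0 := by
  simp [AA, Real.zero_rpow ha.ne']

lemma AA_holder {θ₀ : ℝ} (h : θ₀ ∈ Ioo 0 (π / 2)) {a M : ℝ} (ha : a ∈ Ioo (0 : ℝ) 1)
    {f f' : ℝ → ℝ} (hf : ∀ t ∈ Icc (0 : ℝ) (1 / 2), |f t| ≤ M)
    (hf' : ∀ t ∈ Icc (0 : ℝ) (1 / 2), |f' t| ≤ M)
    (hd : ∀ t ∈ Icc (0 : ℝ) (1 / 2), HasDerivAt f (f' t) t) :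
    HolderOnWith (4 * M).toNNReal a.toNNReal (AA a f) (closure (cone3 θ₀)) := by
  have hM : 0 ≤ M := (abs_nonneg _).trans (hf 0 (by simp))
  refine holder_of (by positivity) ha.1.le ?_
  intro x hx y hy hxy
  have hbd : ∀ z ∈ closure (cone3 θ₀), |AA a f z| ≤ M * ‖z‖ ^ a := by
    intro z hz
    by_cases hz0 : z = 0
    · subst hz0
      simp [AA_zero ha.1, Real.zero_rpow ha.1.ne']
    · exact AA_bd hf (x2_pos h hz hz0)
  by_cases hxe : x = y
  · subst hxe; simp [Real.zero_rpow ha.1.ne']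
  have hdp : 0 < ‖x - y‖ := norm_pos_iff.2 (sub_ne_zero.2 hxe)
  have hdpa : 0 < ‖x - y‖ ^ a := Real.rpow_pos_of_pos hdp _
  rcases le_or_gt ‖y‖ (2 * ‖x - y‖) with hc | hc
  · have k1 : ‖x‖ ^ a ≤ ‖y‖ ^ a := Real.rpow_le_rpow (norm_nonneg x) hxy ha.1.le
    have k2 : ‖y‖ ^ a ≤ 2 ^ a * ‖x - y‖ ^ a := by
      rw [← Real.mul_rpow (by norm_num) hdp.le]
      exact Real.rpow_le_rpow (norm_nonneg y) hc ha.1.le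
    have k3 : (2 : ℝ) ^ a ≤ 2 := by
      calc (2 : ℝ) ^ a ≤ 2 ^ (1 : ℝ) := Real.rpow_le_rpow_of_exponent_le (by norm_num) ha.2.le
        _ = 2 := by simp
    have k4 : ‖y‖ ^ a ≤ 2 * ‖x - y‖ ^ a := k2.trans (by gcongr)
    calc |AA a f x - AA a f y| ≤ |AA a f x| + |AA a f y| := abs_sub _ _
      _ ≤ M * ‖x‖ ^ a + M * ‖y‖ ^ a := add_le_add (hbd x hx) (hbd y hy)
      _ ≤ M * (2 * ‖x - y‖ ^ a) + M * (2 * ‖x - y‖ ^ a) := by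
        gcongr
        exact k1.trans k4
      _ = _ := by ring
  · have hz : ∀ z ∈ closure (cone3 θ₀) ∩ Metric.ball y (‖y‖ / 2),
        0 < z 2 ∧ ‖x - y‖ < ‖z‖ := by
      rintro z ⟨hz1, hz2⟩
      rw [Metric.mem_ball, dist_eq_norm] at hz2
      have t1 : ‖y‖ ≤ ‖z‖ + ‖z - y‖ := by
        calc ‖y‖ = ‖z - (z - y)‖ := by congr 1; abel
          _ ≤ _ := norm_sub_le _ _
      have t2 : ‖x - y‖ < ‖z‖ := by linarith
      refine ⟨x2_pos h hz1 (norm_pos_iff.1 (hdp.trans t2)), t2⟩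
    have hyb : y ∈ closure (cone3 θ₀) ∩ Metric.ball y (‖y‖ / 2) :=
      ⟨hy, Metric.mem_ball_self (by linarith)⟩
    have hxb : x ∈ closure (cone3 θ₀) ∩ Metric.ball y (‖y‖ / 2) :=
      ⟨hx, by rw [Metric.mem_ball, dist_eq_norm]; linarith⟩
    have mv := Convex.norm_image_sub_le_of_norm_hasFDerivWithin_le (𝕜 := ℝ)
      (f := AA a f) (f' := dAA a f f') (C := 2 * M * ‖x - y‖ ^ (a - 1))
      (s := closure (cone3 θ₀) ∩ Metric.ball y (‖y‖ / 2)) (x := y) (y := x)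
      (fun z hzz => (hasFDerivAt_AA a (ne_zero_of (hz z hzz).1)
        (hd _ (tt_mem (hz z hzz).1))).hasFDerivWithinAt)
      (fun z hzz => (dAA_bd ha hf hf' (hz z hzz).1).trans (by
        have := Real.rpow_le_rpow_of_nonpos hdp (hz z hzz).2.le (by linarith [ha.2] : a - 1 ≤ 0)
        gcongr))
      ((closure_convex h).inter (convex_ball _ _)) hyb hxb
    rw [Real.norm_eq_abs, mul_assoc, ← Real.rpow_add_one hdp.ne'] at mv
    rw [sub_add_cancel] at mv
    nlinarith

/-! ### The exponent -/

lemma exists_alpha {θ₀ s : ℝ} (h : θ₀ ∈ Ioo 0 (π / 2))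
    (hs : s ∈ Ioo (-(π / 2)) (-(π / 2) + θ₀ / 2)) :
    ∃ a ∈ Ioo (0 : ℝ) 1,
      a * pS (cC a) ((1 - cos θ₀) / 2) * cos (s - θ₀)
        + 1 / 2 * pS (dC (cC a)) ((1 - cos θ₀) / 2) * sin θ₀ * sin (s - θ₀) = 0 := by
  set t := (1 - cos θ₀) / 2 with ht
  have hcp := cos_pos0 h
  have hcl := cos_lt0 h
  have htm : t ∈ Icc (0 : ℝ) (1 / 2) := by constructor <;> linarith
  have hta := abs_lt_of_mem htm
  let H : ℝ → ℝ := fun a => pS (cC a) t * cos (s - θ₀)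
    - 1 / 2 * (a + 1) * pS (EC a) t * sin θ₀ * sin (s - θ₀)
  have hc : ContinuousOn H (Icc 0 1) := by
    have h1 := pS_cC_cont hta
    have h2 := pS_EC_cont hta
    fun_prop
  have hH0 : H 0 < 0 := by
    have e1 : H 0 = cos (s - θ₀) - 1 / 2 * (1 - t)⁻¹ * sin θ₀ * sin (s - θ₀) := by
      simp only [H, pS_cC_0, pS_EC_0 hta]; ring
    have hh : 0 < cos (θ₀ / 2) :=
      Real.cos_pos_of_mem_Ioo ⟨by linarith [h.1, Real.pi_pos], by linarith [h.1, h.2]⟩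
    have e2 : cos θ₀ = 2 * cos (θ₀ / 2) ^ 2 - 1 := by
      rw [← Real.cos_two_mul]; ring_nf
    have e3 : sin θ₀ = 2 * sin (θ₀ / 2) * cos (θ₀ / 2) := by
      rw [← Real.sin_two_mul]; ring_nf
    have e4 : 1 - t = cos (θ₀ / 2) ^ 2 := by rw [ht, e2]; ring
    have e5 : cos (s - θ₀ / 2) = cos (s - θ₀) * cos (θ₀ / 2) - sin (s - θ₀) * sin (θ₀ / 2) := by
      rw [← Real.cos_add]; ring_nf
    have e6 : H 0 = cos (s - θ₀ / 2) / cos (θ₀ / 2) := by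
      rw [e1, e4, e3, e5]; field_simp
    rw [e6]
    apply div_neg_of_neg_of_pos _ hh
    rw [← Real.cos_neg]
    apply Real.cos_neg_of_pi_div_two_lt_of_lt
    · linarith [hs.2]
    · linarith [hs.1, h.2, Real.pi_pos]
  have hH1 : 0 < H 1 := by
    have e1 : H 1 = cos s := by
      have : cos s = cos (s - θ₀) * cos θ₀ - sin (s - θ₀) * sin θ₀ := by
        rw [← Real.cos_add]; ring_nf
      simp only [H, pS_cC_1, pS_EC_1, this, ht]; ring
    rw [e1]
    exact Real.cos_pos_of_mem_Ioo ⟨hs.1, by linarith [hs.2, h.2, Real.pi_pos]⟩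
  obtain ⟨a, ha, hHa⟩ := intermediate_value_Ioo (zero_le_one' ℝ) hc ⟨hH0, hH1⟩
  refine ⟨a, ha, ?_⟩
  rw [pS_dC]
  simp only [H] at hHa
  linear_combination a * hHa

lemma AA_e3 {a t : ℝ} (f : ℝ → ℝ) (ht : 0 < t) : AA a f (t • e3) = t ^ a * f 0 := by
  have : ‖t • e3‖ = t := by rw [norm_smul, e3_norm, Real.norm_eq_abs, abs_of_pos ht, mul_one]
  have h2 : (t • e3) 2 = t := by simp [e3_2]
  rw [AA, tt, this, h2, div_self ht.ne']; simp

lemma dAA_e3 {a t : ℝ} (f f' : ℝ → ℝ) (ht : 0 < t) :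
    dAA a f f' (t • e3) e3 = a * t ^ (a - 1) * f 0 := by
  have h2 : (t • e3) 2 = t := by simp [e3_2]
  have h3 : innerSL ℝ (t • e3) e3 = t := by
    simp [inner_smul_left, e3_norm]
  simp only [dAA, sub_apply, smul_apply, smul_eq_mul, projE, h3, h2, e3_2, AA_e3 _ ht]
  have r2 : t ^ (a - 1) = t ^ (a - 2) * t := by
    rw [← Real.rpow_add_one ht.ne']; ring_nf
  have r3 : t ^ (a - 2) = t ^ (a - 3) * t := by
    rw [← Real.rpow_add_one ht.ne']; ring_nf
  rw [r2, r3]; ring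

lemma contDiffAt_AA (a : ℝ) {f : ℝ → ℝ} {x : Euc3} (hx : x ≠ 0)
    (hf : ContDiffAt ℝ (⊤ : ℕ∞) f (tt x)) : ContDiffAt ℝ (⊤ : ℕ∞) (AA a f) x := by
  have hn : ‖x‖ ≠ 0 := norm_ne_zero_iff.2 hx
  have h1 : ContDiffAt ℝ (⊤ : ℕ∞) (fun y : Euc3 => ‖y‖) x := contDiffAt_norm ℝ hx
  have h2 : ContDiffAt ℝ (⊤ : ℕ∞) (fun y : Euc3 => y 2) x :=
    (EuclideanSpace.proj 2 : Euc3 →L[ℝ] ℝ).contDiff.contDiffAt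
  have h3 : ContDiffAt ℝ (⊤ : ℕ∞) tt x :=
    (contDiffAt_const.sub (h2.div h1 hn)).div_const 2
  exact (h1.rpow_const_of_ne hn).mul (hf.comp x h3)

lemma obl_inner {θ₀ s : ℝ} (h : θ₀ ∈ Ioo 0 (π / 2)) {x : Euc3} (hx : x ∈ coneBdry3 θ₀) :
    innerSL ℝ x (obliqueVec3 s x) = ‖x‖ * cos (s - θ₀) := by
  have hb := bdry_eq hx
  have hn : 0 < ‖x‖ := hx.1
  have hsin : 0 < sin θ₀ := Real.sin_pos_of_pos_of_lt_pi h.1 (by linarith [h.2, Real.pi_pos])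
  have hsq := norm_sq3 x
  have hr : x 0 ^ 2 + x 1 ^ 2 = (‖x‖ * sin θ₀) ^ 2 := by
    have := Real.sin_sq_add_cos_sq θ₀
    rw [hb] at hsq
    linear_combination -hsq + ‖x‖ ^ 2 * (-this)
  have hrt : √(x 0 ^ 2 + x 1 ^ 2) = ‖x‖ * sin θ₀ := by
    rw [hr, Real.sqrt_sq (by positivity)]
  have e : innerSL ℝ x (obliqueVec3 s x)
      = x 0 * (sin s * x 0 / (‖x‖ * sin θ₀)) + x 1 * (sin s * x 1 / (‖x‖ * sin θ₀))
        + x 2 * cos s := by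
    rw [innerSL_apply_apply, PiLp.inner_apply, Fin.sum_univ_three]
    simp [obliqueVec3, hrt]
    ring
  rw [e, hb, Real.cos_sub]
  field_simp
  linear_combination sin s * hr

theorem counterexample_small_opening_angle
    (θ₀ : ℝ) (hθ₀ : θ₀ ∈ Ioo 0 (π / 2)) :
    ∃ s₀ ∈ Ioo (-(π / 2)) 0,
      ∀ s ∈ Ioo (-(π / 2)) s₀,
        ∃ α ∈ Ioo (0 : ℝ) 1, ∃ u : Euc3 → ℝ, counterexampleProps θ₀ s α u := by
  have hπ := Real.pi_pos
  refine ⟨-(π / 2) + θ₀ / 2, ⟨by linarith [hθ₀.1], by linarith [hθ₀.2]⟩, fun s hs => ?_⟩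
  obtain ⟨a, ha, hroot⟩ := exists_alpha hθ₀ hs
  have ha' : a ∈ Icc (0 : ℝ) 1 := Ioo_subset_Icc_self ha
  have hpb := cC_pb ha'
  set f := pS (cC a) with hf
  set f' := pS (dC (cC a)) with hf'
  set f'' := pS (dC (dC (cC a))) with hf''
  have hd : ∀ t ∈ Icc (0 : ℝ) (1 / 2), HasDerivAt f (f' t) t :=
    fun t ht => hpb.hasDerivAt (abs_lt_of_mem ht)
  have hd' : ∀ t ∈ Icc (0 : ℝ) (1 / 2), HasDerivAt f' (f'' t) t :=
    fun t ht => hpb.dC.hasDerivAt (abs_lt_of_mem ht)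
  have hf0 : f 0 = 1 := by rw [hf, pS_zero]; rfl
  obtain ⟨M1, hM1⟩ := isCompact_Icc.exists_bound_of_continuousOn
    (fun t ht => (hd t ht).continuousAt.continuousWithinAt : ContinuousOn f (Icc 0 (1 / 2)))
  obtain ⟨M2, hM2⟩ := isCompact_Icc.exists_bound_of_continuousOn
    (fun t ht => (hd' t ht).continuousAt.continuousWithinAt : ContinuousOn f' (Icc 0 (1 / 2)))
  have hhol : HolderOnWith (4 * max M1 M2).toNNReal a.toNNReal (AA a f) (closure (cone3 θ₀)) :=
    AA_holder hθ₀ ha (fun t ht => (hM1 t ht).trans (le_max_left _ _))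
      (fun t ht => (hM2 t ht).trans (le_max_right _ _)) hd
  have hfd : ∀ x : Euc3, 0 < x 2 → HasFDerivAt (AA a f) (dAA a f f' x) x :=
    fun x hx => hasFDerivAt_AA a (ne_zero_of hx) (hd _ (tt_mem hx))
  have hfdw : ∀ x ∈ closure (cone3 θ₀), x ≠ 0 →
      fderivWithin ℝ (AA a f) (closure (cone3 θ₀)) x = dAA a f f' x := by
    intro x hx h0
    exact (hfd x (x2_pos hθ₀ hx h0)).hasFDerivWithinAt.fderivWithin (closure_ud hθ₀ x hx)
  have hmem : ∀ t : ℝ, 0 < t → t • e3 ∈ closure (cone3 θ₀) :=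
    fun t ht => subset_closure (smul_e3_mem hθ₀ ht)
  have h0mem : (0 : Euc3) ∈ closure (cone3 θ₀) := by rw [mem_closure_iff0 hθ₀]; simp
  refine ⟨a, ha, AA a f, hhol.continuousOn (Real.toNNReal_pos.2 ha.1), ?_, ?_, ?_, ?_, ?_, ?_,
    ⟨_, hhol.mono inter_subset_left⟩, ?_, ?_⟩
  · rintro x ⟨hx, hx0⟩
    have hp := x2_pos hθ₀ hx hx0
    exact (contDiffAt_AA a hx0 (hpb.contDiffAt (abs_lt_of_mem (tt_mem hp)))).contDiffWithinAt
  · intro x y h2 h01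
    have hn : ‖x‖ = ‖y‖ := by
      have h1 := norm_sq3 x
      have h3 := norm_sq3 y
      rw [h01, h2, ← h3] at h1
      exact (pow_left_inj₀ (norm_nonneg x) (norm_nonneg y) two_ne_zero).1 h1
    simp only [AA, tt, hn, h2]
  · intro l hl x _
    have hn : ‖l • x‖ = l * ‖x‖ := by rw [norm_smul, Real.norm_eq_abs, abs_of_pos hl]
    have h2 : (l • x) 2 = l * x 2 := by simp
    simp only [AA, tt, hn, h2]
    rw [Real.mul_rpow hl.le (norm_nonneg x), mul_div_mul_left _ _ hl.ne']
    ring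
  · refine ⟨(1 : ℝ) • e3, hmem 1 one_pos, ?_⟩
    rw [AA_e3 _ one_pos, hf0]; simp
  · intro x hx
    have hpos : ∀ y ∈ cone3 θ₀, 0 < y 2 := fun y hy =>
      x2_pos hθ₀ (subset_closure hy) (norm_pos_iff.1 hy.1)
    exact lap_AA a (f' := f') (f'' := f'') (cone_open hθ₀) (fun y hy => ne_zero_of (hpos y hy))
      (fun y hy => hd _ (tt_mem (hpos y hy))) (fun y hy => hd' _ (tt_mem (hpos y hy)))
      (fun y hy => ode ha' (abs_lt_of_mem (tt_mem (hpos y hy)))) hx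
  · intro x hx
    have hb := bdry_eq hx
    have hn : 0 < ‖x‖ := hx.1
    have hx0 : x ≠ 0 := norm_pos_iff.1 hn
    rw [hfdw x ((mem_closure_iff0 hθ₀ x).2 hb.ge) hx0]
    have htx : tt x = (1 - cos θ₀) / 2 := by
      rw [tt, hb]; field_simp
    have h2 : (obliqueVec3 s x) 2 = cos s := by simp [obliqueVec3]
    have k1 := AA_sub a 1 f' hx0
    have k2 := AA_sub a 2 f hx0
    have k3 := AA_sub a 3 f' hx0
    push_cast at k1 k2 k3
    have hcs : cos s = cos (s - θ₀) * cos θ₀ - sin (s - θ₀) * sin θ₀ := by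
      rw [← Real.cos_add]; ring_nf
    have hin := obl_inner (s := s) hθ₀ hx
    simp only [dAA, sub_apply, smul_apply, smul_eq_mul, projE, hin, h2, k1, k2, k3, htx, hcs]
    rw [hb]
    field_simp
    linear_combination ‖x‖ ^ a * 2 * hroot
  · intro ε hε K δ hδ hH
    have hlim : Filter.Tendsto (fun t : ℝ => (K : ℝ) * t ^ ε) (nhdsWithin 0 (Ioi 0)) (nhds 0) := by
      have h1 : Filter.Tendsto (fun t : ℝ => (K : ℝ) * t ^ ε) (nhds 0) (nhds (K * 0 ^ ε)) :=
        ((Real.continuousAt_rpow_const 0 ε (Or.inr hε.le)).tendsto).const_mul _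
      rw [Real.zero_rpow hε.ne', mul_zero] at h1
      exact h1.mono_left nhdsWithin_le_nhds
    have hev := hlim.eventually (gt_mem_nhds one_pos)
    have hev2 : ∀ᶠ t : ℝ in nhdsWithin 0 (Ioi 0), t < δ :=
      nhdsWithin_le_nhds (gt_mem_nhds hδ)
    obtain ⟨t, ⟨ht1, ht2⟩, ht0⟩ := ((hev.and hev2).and self_mem_nhdsWithin).exists
    have ht0 : 0 < t := ht0
    have hnt : ‖t • e3‖ = t := by
      rw [norm_smul, e3_norm, Real.norm_eq_abs, abs_of_pos ht0, mul_one]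
    have := hH.dist_le (x := t • e3) (y := 0) ⟨hmem t ht0, by simpa [hnt] using ht2⟩
      ⟨h0mem, by simpa using hδ⟩
    rw [AA_zero ha.1, AA_e3 _ ht0, hf0, dist_zero_right, dist_zero_right, hnt, mul_one,
      Real.coe_toNNReal _ (by linarith [ha.1]), Real.rpow_add ht0, Real.norm_eq_abs,
      abs_of_pos (Real.rpow_pos_of_pos ht0 a)] at this
    have hta := Real.rpow_pos_of_pos ht0 a
    nlinarith
  · rintro ⟨G, hG, hGe⟩
    have hc : Filter.Tendsto (fun t : ℝ => t • e3) (nhdsWithin 0 (Ioi 0))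
        (nhdsWithin 0 (closure (cone3 θ₀))) := by
      rw [tendsto_nhdsWithin_iff]
      refine ⟨?_, ?_⟩
      · have : Continuous (fun t : ℝ => t • e3) := by fun_prop
        have := (this.tendsto 0).mono_left (nhdsWithin_le_nhds (s := Ioi 0))
        simpa using this
      · filter_upwards [self_mem_nhdsWithin] with t ht using hmem t ht
    have h1 : Filter.Tendsto (fun t : ℝ => G (t • e3) e3) (nhdsWithin 0 (Ioi 0))
        (nhds (G 0 e3)) := by
      have h2 : Filter.Tendsto (fun t : ℝ => G (t • e3)) (nhdsWithin 0 (Ioi 0)) (nhds (G 0)) :=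
        (hG 0 h0mem).tendsto.comp hc
      exact ((ContinuousLinearMap.apply ℝ ℝ e3).continuous.tendsto (G 0)).comp h2
    have h3 : Filter.Tendsto (fun t : ℝ => a * t ^ (a - 1)) (nhdsWithin 0 (Ioi 0))
        Filter.atTop :=
      (tendsto_rpow_neg_nhdsGT_zero (by linarith [ha.2] : a - 1 < 0)).const_mul_atTop ha.1
    refine not_tendsto_nhds_of_tendsto_atTop h3 (G 0 e3) (h1.congr' ?_)
    filter_upwards [self_mem_nhdsWithin] with t ht
    have ht : 0 < t := ht
    have hne : t • e3 ≠ 0 := ne_zero_of (by simp [e3_2, ht])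
    rw [hGe _ ⟨hmem t ht, hne⟩, hfdw _ (hmem t ht) hne, dAA_e3 _ _ ht, hf0, mul_one]
end
end

section
/- Comparison principle, second version (Theorem 5.1, problem (5.2)). Let n ≥ 3 be an integer, a₁, a₂ > 0 constants, and define the operator L₀u = a₁ ∂²u/∂y₁² + a₂ ∂²u/∂y₂² + ((n−2)a₂ / y₂) ∂u/∂y₂ for functions on ω. Let β₀ = (β₁, β₂) be a constant vector with β₀·ν > 0, let ã ∈ ℝ and b̃ > 0 be constants, and let c̃₀ : ω → ℝ satisfy c̃₀(y) < 0 for all y ∈ ω. Suppose u ∈ C²(ω) ∩ C¹(ω̄ ∖ {0}) ∩ C(ω̄) satisfies: L₀u + c̃₀·u ≤ 0 in ω; u ≥ 0 on the closure of γ_symm ∪ γ_ball; and β₀·Du + ã·(τ·Du) − (b̃/y₂)·u ≤ 0 on γ_cone. Then u ≥ 0 throughout ω̄. -/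
noncomputable section
open Real Set

abbrev Euc2 := EuclideanSpace ℝ (Fin 2)

/-- The vector `(a, b) ∈ ℝ²` as an element of `EuclideanSpace ℝ (Fin 2)`. -/
def vec2 (a b : ℝ) : Euc2 := (WithLp.equiv 2 (Fin 2 → ℝ)).symm ![a, b]

/-- Partial derivative in the `i`-th coordinate direction. -/
def pdy (i : Fin 2) (u : Euc2 → ℝ) (y : Euc2) : ℝ :=
  fderiv ℝ u y (EuclideanSpace.single i 1)

/-- Second partial derivative `∂_i ∂_j u`. -/
def pdy₂ (i j : Fin 2) (u : Euc2 → ℝ) (y : Euc2) : ℝ :=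
  pdy i (pdy j u) y

/-- The polar angle `θ(y) ∈ [0,π]` of `y = (y₁, y₂)`, with `y₁ = |y| cos θ`. -/
def polarAngle2 (y : Euc2) : ℝ := Real.arccos (y 0 / ‖y‖)

/-- The two-dimensional symmetry domain
`ω = {(y₁,y₂) : y₂ ≥ 0, 0 < |y| < R, θ < θ₀}`. -/
def omega2 (R θ₀ : ℝ) : Set Euc2 :=
  {y | 0 ≤ y 1 ∧ 0 < ‖y‖ ∧ ‖y‖ < R ∧ polarAngle2 y < θ₀}

/-- The interior part `{y₂ > 0}` of `ω`, where the operator `L₀` is non-singular. -/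
def omega2O (R θ₀ : ℝ) : Set Euc2 :=
  {y | 0 < y 1 ∧ ‖y‖ < R ∧ polarAngle2 y < θ₀}

/-- `γ_cone = {0 < |y| < R, θ = θ₀}`. -/
def gammaCone2 (R θ₀ : ℝ) : Set Euc2 :=
  {y | 0 ≤ y 1 ∧ 0 < ‖y‖ ∧ ‖y‖ < R ∧ polarAngle2 y = θ₀}

/-- `γ_symm = {0 < |y| < R, θ = 0}`. -/
def gammaSymm2 (R : ℝ) : Set Euc2 :=
  {y | 0 < y 0 ∧ y 0 < R ∧ y 1 = 0}

/-- `γ_ball = {|y| = R, θ ∈ (0,θ₀)}`. -/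
def gammaBall2 (R θ₀ : ℝ) : Set Euc2 :=
  {y | ‖y‖ = R ∧ 0 < y 1 ∧ polarAngle2 y < θ₀}

/-- The operator `L₀u = a₁ u_{y₁y₁} + a₂ u_{y₂y₂} + ((n−2) a₂ / y₂) u_{y₂}`,
the axi-symmetric reduction of a rotationally invariant constant-coefficient
elliptic operator on `ℝⁿ`. -/
def Lop (n : ℕ) (a₁ a₂ : ℝ) (u : Euc2 → ℝ) (y : Euc2) : ℝ :=
  a₁ * pdy₂ 0 0 u y + a₂ * pdy₂ 1 1 u y + ((n : ℝ) - 2) * a₂ / y 1 * pdy 1 u y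

/-- The inward unit normal on `γ_cone`. -/
def nuVec (θ₀ : ℝ) : Euc2 := vec2 (Real.sin θ₀) (-Real.cos θ₀)

/-- The unit tangent on `γ_cone`. -/
def tauVec (θ₀ : ℝ) : Euc2 := vec2 (-Real.cos θ₀) (-Real.sin θ₀)

theorem cp_norm_sq (y : Euc2) : ‖y‖ ^ 2 = y 0 ^ 2 + y 1 ^ 2 := by
  rw [EuclideanSpace.norm_sq_eq]; simp [Fin.sum_univ_two]

theorem cp_vec2_0 (a b : ℝ) : vec2 a b 0 = a := by simp [vec2]
theorem cp_vec2_1 (a b : ℝ) : vec2 a b 1 = b := by simp [vec2]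

theorem cp_ext {x y : Euc2} (h0 : x 0 = y 0) (h1 : x 1 = y 1) : x = y := by
  ext i; fin_cases i
  · exact h0
  · exact h1

theorem cp_cont_coord (i : Fin 2) : Continuous (fun y : Euc2 => y i) := by fun_prop

theorem cp_cont_vec2 {f g : ℝ → ℝ} (hf : Continuous f) (hg : Continuous g) :
    Continuous (fun t => vec2 (f t) (g t)) := by
  unfold vec2
  refine (PiLp.continuous_toLp 2 (fun _ : Fin 2 => ℝ)).comp ?_
  refine continuous_pi (fun i => ?_)
  fin_cases i
  · simpa using hf
  · simpa using hg

theorem cp_cos {y : Euc2} (hy : 0 < ‖y‖) : ‖y‖ * cos (polarAngle2 y) = y 0 := by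
  have h := cp_norm_sq y
  have habs : |y 0| ≤ ‖y‖ := abs_le_of_sq_le_sq (by nlinarith [sq_nonneg (y 1)]) hy.le
  have h2 := abs_le.1 habs
  unfold polarAngle2
  rw [Real.cos_arccos]
  · field_simp
  · rw [le_div_iff₀ hy]; linarith
  · rw [div_le_iff₀ hy]; linarith

theorem cp_sin {y : Euc2} (hy : 0 < ‖y‖) (h1 : 0 ≤ y 1) : ‖y‖ * sin (polarAngle2 y) = y 1 := by
  have h := cp_norm_sq y
  have hc := cp_cos hy
  have hs : 0 ≤ sin (polarAngle2 y) :=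
    Real.sin_nonneg_of_nonneg_of_le_pi (Real.arccos_nonneg _) (Real.arccos_le_pi _)
  have hsc := Real.sin_sq_add_cos_sq (polarAngle2 y)
  have : (‖y‖ * sin (polarAngle2 y)) ^ 2 = y 1 ^ 2 := by
    have : (‖y‖ * sin (polarAngle2 y)) ^ 2 + (‖y‖ * cos (polarAngle2 y)) ^ 2 = ‖y‖ ^ 2 := by
      rw [mul_pow, mul_pow, ← mul_add, hsc, mul_one]
    rw [hc] at this; linarith
  exact (sq_eq_sq₀ (by positivity) h1).1 this

/-- signed distance to the cone line -/
def cpG (θ₀ : ℝ) (y : Euc2) : ℝ := y 0 * sin θ₀ - y 1 * cos θ₀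

theorem cp_g_eq (θ₀ : ℝ) {y : Euc2} (hy : 0 < ‖y‖) (h1 : 0 ≤ y 1) :
    cpG θ₀ y = ‖y‖ * sin (θ₀ - polarAngle2 y) := by
  unfold cpG
  rw [Real.sin_sub, ← cp_sin hy h1, ← cp_cos hy]; ring

theorem cp_g_pos {θ₀ : ℝ} (hθ₀ : θ₀ ∈ Ioo 0 π) {y : Euc2} (hy : 0 < ‖y‖) (h1 : 0 ≤ y 1) :
    0 < cpG θ₀ y ↔ polarAngle2 y < θ₀ := by
  rw [cp_g_eq θ₀ hy h1]
  have h0 : 0 ≤ polarAngle2 y := Real.arccos_nonneg _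
  have hpi : polarAngle2 y ≤ π := Real.arccos_le_pi _
  constructor
  · intro h
    by_contra hc
    have := Real.sin_nonpos_of_nonpos_of_neg_pi_le (x := θ₀ - polarAngle2 y)
      (by linarith) (by linarith [hθ₀.1])
    nlinarith
  · intro h
    exact mul_pos hy (Real.sin_pos_of_pos_of_lt_pi (by linarith) (by linarith [hθ₀.2]))

theorem cp_g_nonneg {θ₀ : ℝ} (hθ₀ : θ₀ ∈ Ioo 0 π) {y : Euc2} (hy : 0 < ‖y‖) (h1 : 0 < y 1)
    (hg : 0 ≤ cpG θ₀ y) : polarAngle2 y ≤ θ₀ := by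
  rw [cp_g_eq θ₀ hy h1.le] at hg
  have hpi : polarAngle2 y ≤ π := Real.arccos_le_pi _
  by_contra hc
  have := Real.sin_neg_of_neg_of_neg_pi_lt (x := θ₀ - polarAngle2 y)
      (by linarith) (by linarith [hθ₀.1])
  nlinarith

theorem cp_norm_pos {y : Euc2} (h1 : 0 < y 1) : 0 < ‖y‖ := by
  rw [norm_pos_iff]; rintro rfl; simp at h1

theorem cp_cont_g (θ₀ : ℝ) : Continuous (cpG θ₀) := by
  unfold cpG; fun_prop

theorem cp_omega2O_eq (R : ℝ) {θ₀ : ℝ} (hθ₀ : θ₀ ∈ Ioo 0 π) :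
    omega2O R θ₀ = {y | 0 < y 1} ∩ ({y | ‖y‖ < R} ∩ {y | 0 < cpG θ₀ y}) := by
  ext y
  simp only [omega2O, mem_setOf_eq, mem_inter_iff]
  constructor
  · rintro ⟨a, b, c⟩; exact ⟨a, b, (cp_g_pos hθ₀ (cp_norm_pos a) a.le).2 c⟩
  · rintro ⟨a, b, c⟩; exact ⟨a, b, (cp_g_pos hθ₀ (cp_norm_pos a) a.le).1 c⟩

theorem cp_isOpen (R : ℝ) {θ₀ : ℝ} (hθ₀ : θ₀ ∈ Ioo 0 π) : IsOpen (omega2O R θ₀) := by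
  rw [cp_omega2O_eq R hθ₀]
  exact (isOpen_lt continuous_const (cp_cont_coord 1)).inter
    ((isOpen_lt continuous_norm continuous_const).inter
      (isOpen_lt continuous_const (cp_cont_g θ₀)))

theorem cp_sub {R θ₀ : ℝ} : omega2O R θ₀ ⊆ omega2 R θ₀ := by
  rintro y ⟨a, b, c⟩; exact ⟨a.le, cp_norm_pos a, b, c⟩

theorem cp_closure {R θ₀ : ℝ} (hθ₀ : θ₀ ∈ Ioo 0 π) {y : Euc2}
    (hy : y ∈ closure (omega2 R θ₀)) : 0 ≤ y 1 ∧ ‖y‖ ≤ R ∧ 0 ≤ cpG θ₀ y := by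
  have hcl : IsClosed ({y : Euc2 | 0 ≤ y 1} ∩ ({y | ‖y‖ ≤ R} ∩ {y | 0 ≤ cpG θ₀ y})) :=
    (isClosed_le continuous_const (cp_cont_coord 1)).inter
    ((isClosed_le continuous_norm continuous_const).inter
      (isClosed_le continuous_const (cp_cont_g θ₀)))
  refine closure_minimal ?_ hcl hy
  rintro z ⟨a, b, c, d⟩
  exact ⟨a, c.le, ((cp_g_pos hθ₀ b a).2 d).le⟩

theorem cp_symm {R : ℝ} (hR : 0 < R) {y : Euc2} (h0 : 0 ≤ y 0) (h0R : y 0 ≤ R) (h1 : y 1 = 0) :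
    y ∈ closure (gammaSymm2 R) := by
  have hc := cp_cont_vec2 (f := fun t => t) (g := fun _ => 0) continuous_id continuous_const
  have : y = vec2 (y 0) 0 := cp_ext (by rw [cp_vec2_0]) (by rw [cp_vec2_1, h1])
  rw [this]
  refine map_mem_closure (s := Ioo 0 R) (f := fun t => vec2 t 0) hc ?_ ?_
  · rw [closure_Ioo hR.ne]; exact ⟨h0, h0R⟩
  · intro t ht
    refine ⟨?_, ?_, ?_⟩
    · rw [cp_vec2_0]; exact ht.1
    · rw [cp_vec2_0]; exact ht.2
    · rw [cp_vec2_1]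

theorem cp_ball {R θ₀ : ℝ} (hR : 0 < R) (hθ₀ : θ₀ ∈ Ioo 0 π) {y : Euc2}
    (hn : ‖y‖ = R) (h1 : 0 < y 1) (ha : polarAngle2 y ≤ θ₀) :
    y ∈ closure (gammaBall2 R θ₀) := by
  have hc := cp_cont_vec2 (f := fun t => R * cos t) (g := fun t => R * sin t)
    (by fun_prop) (by fun_prop)
  have hy := cp_norm_pos h1
  have : y = vec2 (R * cos (polarAngle2 y)) (R * sin (polarAngle2 y)) := by
    apply cp_ext
    · rw [cp_vec2_0, ← hn, cp_cos hy]
    · rw [cp_vec2_1, ← hn, cp_sin hy h1.le]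
  rw [this]
  refine map_mem_closure (s := Ioo 0 θ₀) (f := fun t => vec2 (R * cos t) (R * sin t)) hc ?_ ?_
  · rw [closure_Ioo hθ₀.1.ne]; exact ⟨Real.arccos_nonneg _, ha⟩
  · intro t ht
    have hs : 0 < sin t := Real.sin_pos_of_pos_of_lt_pi ht.1 (ht.2.trans hθ₀.2)
    have hnn : ‖vec2 (R * cos t) (R * sin t)‖ = R := by
      refine (sq_eq_sq₀ (norm_nonneg _) hR.le).1 ?_
      rw [cp_norm_sq, cp_vec2_0, cp_vec2_1]
      linear_combination R ^ 2 * Real.sin_sq_add_cos_sq t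
    refine ⟨hnn, ?_, ?_⟩
    · rw [cp_vec2_1]; positivity
    · unfold polarAngle2
      rw [hnn, cp_vec2_0, mul_div_cancel_left₀ _ hR.ne',
        Real.arccos_cos ht.1.le (ht.2.trans hθ₀.2).le]
      exact ht.2

theorem cp_second_1d {f : ℝ → ℝ} {x : ℝ} (hmin : IsLocalMin f x) (hc : ContinuousAt f x) :
    0 ≤ deriv (deriv f) x := by
  by_contra hneg
  push Not at hneg
  have hmax := isLocalMax_of_deriv_deriv_neg hneg hmin.deriv_eq_zero hc
  have hconst : f =ᶠ[nhds x] fun _ => f x := by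
    filter_upwards [hmin, hmax] with z h1 h2 using le_antisymm h2 h1
  have h1 := hconst.deriv.deriv_eq
  simp at h1
  rw [h1] at hneg
  exact lt_irrefl _ hneg

theorem cp_second {u : Euc2 → ℝ} {y : Euc2} (hmin : IsLocalMin u y) (hu : ContDiffAt ℝ 2 u y)
    (i : Fin 2) : 0 ≤ pdy₂ i i u y := by
  set e : Euc2 := EuclideanSpace.single i 1 with he
  let l : ℝ → Euc2 := fun t => y + t • e
  have hl : ∀ t, HasDerivAt l e t := fun t => by
    have h := ((hasDerivAt_id t).smul_const e).const_add y
    rw [one_smul] at h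
    exact h
  have hl0 : l 0 = y := by simp [l]
  have hlc : Filter.Tendsto l (nhds 0) (nhds y) := by
    have := (hl 0).continuousAt.tendsto
    rwa [hl0] at this
  have hdiff : ∀ᶠ z in nhds y, DifferentiableAt ℝ u z := by
    filter_upwards [hu.eventually (by simp)] with z hz using hz.differentiableAt (by simp)
  have hd : deriv (u ∘ l) =ᶠ[nhds 0] (pdy i u) ∘ l := by
    filter_upwards [hlc.eventually hdiff] with t ht
    exact (ht.hasFDerivAt.comp_hasDerivAt t (hl t)).deriv
  have hp : DifferentiableAt ℝ (pdy i u) y := by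
    have : ContDiffAt ℝ 1 (fderiv ℝ u) y := hu.fderiv_right (by norm_num)
    exact (this.differentiableAt (by simp)).clm_apply (differentiableAt_const _)
  have hdd : deriv (deriv (u ∘ l)) 0 = pdy₂ i i u y := by
    rw [hd.deriv_eq]
    have hp' : HasFDerivAt (pdy i u) (fderiv ℝ (pdy i u) y) (l 0) := by
      rw [hl0]; exact hp.hasFDerivAt
    exact (hp'.comp_hasDerivAt 0 (hl 0)).deriv
  rw [← hdd]
  apply cp_second_1d
  · have := hlc.eventually hmin
    filter_upwards [this] with t ht
    simpa [hl0] using ht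
  · have : ContinuousAt u (l 0) := by rw [hl0]; exact hu.continuousAt
    exact this.comp (hl 0).continuousAt

theorem comparison_principle_second_version
    (n : ℕ) (hn : 3 ≤ n) (R θ₀ : ℝ) (hR : 0 < R) (hθ₀ : θ₀ ∈ Ioo 0 π)
    (a₁ a₂ : ℝ) (ha₁ : 0 < a₁) (ha₂ : 0 < a₂)
    (β₁ β₂ atil btil : ℝ) (hbtil : 0 < btil)
    (hoblique : 0 < β₁ * Real.sin θ₀ + β₂ * (-Real.cos θ₀))
    (c₀ : Euc2 → ℝ) (hc₀ : ∀ y ∈ omega2O R θ₀, c₀ y < 0)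
    (u : Euc2 → ℝ)
    (hu2 : ContDiffOn ℝ 2 u (omega2O R θ₀))
    (hu1 : ContDiffOn ℝ 1 u (closure (omega2 R θ₀) \ {0}))
    (hu0 : ContinuousOn u (closure (omega2 R θ₀)))
    (hPDE : ∀ y ∈ omega2O R θ₀, Lop n a₁ a₂ u y + c₀ y * u y ≤ 0)
    (hside : ∀ y ∈ closure (gammaSymm2 R ∪ gammaBall2 R θ₀), 0 ≤ u y)
    (hcone : ∀ y ∈ gammaCone2 R θ₀,
      fderivWithin ℝ u (closure (omega2 R θ₀)) y (vec2 β₁ β₂)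
        + atil * fderivWithin ℝ u (closure (omega2 R θ₀)) y (tauVec θ₀)
        - btil / y 1 * u y ≤ 0) :
    ∀ y ∈ closure (omega2 R θ₀), 0 ≤ u y := by
  have hbdd : Bornology.IsBounded (closure (omega2 R θ₀)) := by
    refine (Metric.isBounded_closedBall (x := (0 : Euc2)) (r := R)).subset ?_
    intro y hy
    simpa using (cp_closure hθ₀ hy).2.1
  have hcomp : IsCompact (closure (omega2 R θ₀)) :=
    Metric.isCompact_of_isClosed_isBounded isClosed_closure hbdd
  intro x hx
  obtain ⟨y, hy, hmin⟩ := hcomp.exists_isMinOn ⟨x, hx⟩ hu0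
  refine le_trans ?_ (hmin hx)
  by_contra hneg
  push Not at hneg
  obtain ⟨h1, hnR, hg⟩ := cp_closure hθ₀ hy
  have hsin : 0 < sin θ₀ := Real.sin_pos_of_pos_of_lt_pi hθ₀.1 hθ₀.2
  rcases h1.eq_or_lt with h1 | h1
  · have h1 := h1.symm
    have h0 : 0 ≤ y 0 := by
      unfold cpG at hg
      rw [h1] at hg
      by_contra hc
      push Not at hc
      nlinarith
    have h0R : y 0 ≤ R := by
      have := cp_norm_sq y
      rw [h1] at this
      nlinarith [norm_nonneg y]
    exact absurd (hside y (closure_mono subset_union_left (cp_symm hR h0 h0R h1))) (not_le.2 hneg)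
  have hpos := cp_norm_pos h1
  have hang := cp_g_nonneg hθ₀ hpos h1 hg
  rcases hnR.eq_or_lt with hnR | hnR
  · exact absurd (hside y (closure_mono subset_union_right (cp_ball hR hθ₀ hnR h1 hang)))
      (not_le.2 hneg)
  rcases hang.eq_or_lt with hang | hang
  · -- cone
    have hc := hcone y ⟨h1.le, hpos, hnR, hang⟩
    have hg0 : cpG θ₀ y = 0 := by rw [cp_g_eq θ₀ hpos h1.le, hang]; simp
    set v : Euc2 := vec2 β₁ β₂ + atil • tauVec θ₀ with hv
    have hgv : 0 < cpG θ₀ v := by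
      have h0 : v 0 = β₁ + atil * (-cos θ₀) := by
        simp [hv, tauVec, cp_vec2_0]
      have h1 : v 1 = β₂ + atil * (-sin θ₀) := by
        simp [hv, tauVec, cp_vec2_1]
      unfold cpG
      rw [h0, h1]
      linarith
    have hcone' : v ∈ posTangentConeAt (closure (omega2 R θ₀)) y := by
      apply mem_posTangentConeAt_of_frequently_mem
      apply Filter.Eventually.frequently
      have hct : Continuous (fun t : ℝ => y + t • v) := by fun_prop
      have e1 : ∀ᶠ t : ℝ in nhds 0, 0 < (y + t • v) 1 := by
        refine ((cp_cont_coord 1).comp hct).continuousAt.eventually_const_lt ?_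
        simpa using h1
      have e2 : ∀ᶠ t : ℝ in nhds 0, ‖y + t • v‖ < R := by
        refine (continuous_norm.comp hct).continuousAt.eventually_lt_const ?_
        simpa using hnR
      filter_upwards [nhdsWithin_le_nhds e1, nhdsWithin_le_nhds e2, self_mem_nhdsWithin]
        with t k1 k2 k3
      apply subset_closure
      apply cp_sub
      rw [cp_omega2O_eq R hθ₀]
      refine ⟨k1, k2, ?_⟩
      have : cpG θ₀ (y + t • v) = cpG θ₀ y + t * cpG θ₀ v := by
        simp [cpG]; ring
      rw [mem_setOf_eq, this, hg0, zero_add]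
      exact mul_pos k3 hgv
    have hd := hmin.localize.fderivWithin_nonneg hcone'
    rw [hv, map_add, map_smul, smul_eq_mul] at hd
    have : btil / y 1 * u y < 0 := mul_neg_of_pos_of_neg (by positivity) hneg
    linarith
  · have hO : y ∈ omega2O R θ₀ := ⟨h1, hnR, hang⟩
    have hnb : omega2O R θ₀ ∈ nhds y := (cp_isOpen R hθ₀).mem_nhds hO
    have hlm : IsLocalMin u y :=
      hmin.isLocalMin (Filter.mem_of_superset hnb (cp_sub.trans subset_closure))
    have hcd := hu2.contDiffAt hnb
    have k0 := cp_second hlm hcd 0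
    have k1 := cp_second hlm hcd 1
    have kg : pdy 1 u y = 0 := by simp [pdy, hlm.fderiv_eq_zero]
    have hP := hPDE y hO
    have hcu := mul_pos_of_neg_of_neg (hc₀ y hO) hneg
    unfold Lop at hP
    rw [kg, mul_zero] at hP
    have := mul_nonneg ha₁.le k0
    have := mul_nonneg ha₂.le k1
    linarith
end
end
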